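/- arXiv:2501.01922 — 9 statements merged into one kernel-verified Lean document; each statement's English description precedes it below -/
import Mathlib

section
/- The map Φ from the direct product (unitary ℍ) × (unitary ℍ) of the group of unit quaternions with itself to the group of ℝ-linear isometric equivalences of ℍ, sending a pair (p,q) to the map x ↦ p * x * q⁻¹, is a group homomorphism, and its kernel is exactly the two-element set {(1,1), (-1,-1)}. -/
open scoped Quaternion

namespace Quaternion

/-- A quaternion commuting with every quaternion is real. -/
theorem eq_coe_re_of_forall_commute {a : ℍ[ℝ]} (h : ∀ x, Commute a x) : a = (a.re : ℍ[ℝ]) := by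
  have hJ (x : ℍ[ℝ]) : (a * x).imJ = (x * a).imJ := by rw [(h x).eq]
  have hK (x : ℍ[ℝ]) : (a * x).imK = (x * a).imK := by rw [(h x).eq]
  simp only [imJ_mul, imK_mul] at hJ hK
  have hiJ := hJ ⟨0, 1, 0, 0⟩
  have hiK := hK ⟨0, 1, 0, 0⟩
  have hjK := hK ⟨0, 0, 1, 0⟩
  ext <;> simp <;> linarith

/-- The isometry `x ↦ p * x * q⁻¹` attached to a pair `(p, q)` of unit quaternions. -/
noncomputable def unitaryMulLeftRight (a : unitary ℍ[ℝ] × unitary ℍ[ℝ]) : ℍ[ℝ] ≃ₗᵢ[ℝ] ℍ[ℝ] where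
  toFun x := a.1 * x * (a.2 : ℍ[ℝ])⁻¹
  map_add' x y := by rw [mul_add, add_mul]
  map_smul' r x := by simp
  invFun x := (a.1 : ℍ[ℝ])⁻¹ * x * a.2
  left_inv x := by
    have hp := (Unitary.toUnits a.1).ne_zero
    have hq := (Unitary.toUnits a.2).ne_zero
    simp only [Unitary.val_toUnits_apply] at hp hq
    simp only [mul_assoc, inv_mul_cancel₀ hq, mul_one, inv_mul_cancel_left₀ hp]
  right_inv x := by
    have hp := (Unitary.toUnits a.1).ne_zero
    have hq := (Unitary.toUnits a.2).ne_zero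
    simp only [Unitary.val_toUnits_apply] at hp hq
    simp only [mul_assoc, mul_inv_cancel₀ hq, mul_one, mul_inv_cancel_left₀ hp]
  norm_map' x := by
    change ‖(a.1 : ℍ[ℝ]) * x * (a.2 : ℍ[ℝ])⁻¹‖ = ‖x‖
    simp [CStarRing.norm_of_mem_unitary a.1.2, CStarRing.norm_of_mem_unitary a.2.2]

theorem unitaryMulLeftRight_apply (a : unitary ℍ[ℝ] × unitary ℍ[ℝ]) (x : ℍ[ℝ]) :
    unitaryMulLeftRight a x = a.1 * x * (a.2 : ℍ[ℝ])⁻¹ := rfl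

/-- `unitaryMulLeftRight` as a group homomorphism. -/
noncomputable def unitaryMulLeftRightHom :
    unitary ℍ[ℝ] × unitary ℍ[ℝ] →* (ℍ[ℝ] ≃ₗᵢ[ℝ] ℍ[ℝ]) :=
  MonoidHom.mk' unitaryMulLeftRight fun a b => by
    ext1 x
    simp only [LinearIsometryEquiv.coe_mul, Function.comp_apply, unitaryMulLeftRight_apply,
      Prod.fst_mul, Prod.snd_mul, Submonoid.coe_mul, mul_inv_rev, mul_assoc]

theorem unitaryMulLeftRightHom_apply (a : unitary ℍ[ℝ] × unitary ℍ[ℝ]) (x : ℍ[ℝ]) :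
    unitaryMulLeftRightHom a x = a.1 * x * (a.2 : ℍ[ℝ])⁻¹ := rfl

/-- A unit quaternion commuting with every quaternion is `1` or `-1`. -/
theorem unitary_eq_one_or_neg_one {p : unitary ℍ[ℝ]} (h : ∀ x, Commute (p : ℍ[ℝ]) x) :
    p = 1 ∨ p = -1 := by
  have hre := eq_coe_re_of_forall_commute h
  have hn := CStarRing.norm_of_mem_unitary p.2
  rw [hre, norm_coe, Real.norm_eq_abs] at hn
  rcases eq_or_eq_neg_of_abs_eq hn with h1 | h1
  · exact Or.inl (Subtype.ext (by rw [hre, h1]; simp))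
  · exact Or.inr (Subtype.ext (by rw [hre, h1]; simp [Unitary.coe_neg]))

theorem coe_ker_unitaryMulLeftRightHom :
    (unitaryMulLeftRightHom.ker : Set (unitary ℍ[ℝ] × unitary ℍ[ℝ])) = {(1, 1), (-1, -1)} := by
  ext ⟨p, q⟩
  simp only [SetLike.mem_coe, MonoidHom.mem_ker, Set.mem_insert_iff, Set.mem_singleton_iff]
  constructor
  · intro h
    have hx (x : ℍ[ℝ]) : (p : ℍ[ℝ]) * x * (q : ℍ[ℝ])⁻¹ = x := by
      rw [← unitaryMulLeftRightHom_apply (p, q), h, LinearIsometryEquiv.coe_one, id]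
    have hq : (q : ℍ[ℝ]) ≠ 0 := (Unitary.toUnits q).ne_zero
    have hpq : p = q := Subtype.ext <| by
      simpa using (mul_inv_eq_iff_eq_mul₀ hq).1 (hx 1)
    subst hpq
    rcases unitary_eq_one_or_neg_one fun x => (mul_inv_eq_iff_eq_mul₀ hq).1 (hx x) with rfl | rfl
    · exact Or.inl rfl
    · exact Or.inr rfl
  · rintro (h | h) <;> rw [h] <;> ext1 x <;> simp [unitaryMulLeftRightHom_apply, Unitary.coe_neg]

end Quaternion


/-- The map `Φ : (unitary ℍ) × (unitary ℍ) → (ℍ ≃ₗᵢ[ℝ] ℍ)`, sending `(p, q)` to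
`x ↦ p * x * q⁻¹`, is a group homomorphism whose kernel is exactly
`{(1, 1), (-1, -1)}`. -/
theorem phi_hom_and_kernel :
    ∃ Φ : (unitary (Quaternion ℝ) × unitary (Quaternion ℝ)) →*
        ((Quaternion ℝ) ≃ₗᵢ[ℝ] (Quaternion ℝ)),
      (∀ (p q : unitary (Quaternion ℝ)) (x : Quaternion ℝ),
          Φ (p, q) x = (p : Quaternion ℝ) * x * (q : Quaternion ℝ)⁻¹) ∧
      (Φ.ker : Set (unitary (Quaternion ℝ) × unitary (Quaternion ℝ)))
        = {((1 : unitary (Quaternion ℝ)), (1 : unitary (Quaternion ℝ))),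
           ((-1 : unitary (Quaternion ℝ)), (-1 : unitary (Quaternion ℝ)))} := by
  exact ⟨Quaternion.unitaryMulLeftRightHom,
    fun p q => Quaternion.unitaryMulLeftRightHom_apply (p, q),
    Quaternion.coe_ker_unitaryMulLeftRightHom⟩
end

section
/- Every ℝ-linear isometric equivalence f of the quaternions ℍ whose determinant (as an ℝ-linear automorphism of the 4-dimensional real vector space ℍ) equals 1 is of the form x ↦ p * x * q⁻¹ for some unit quaternions p and q; that is, the homomorphism Φ from (unitary ℍ) × (unitary ℍ) to the linear isometries of ℍ given by Φ(p,q)(x) = p x q⁻¹ surjects onto the orientation-preserving linear isometries of ℍ. -/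
open Quaternion in
/-- The reflection in the hyperplane orthogonal to a unit quaternion `v` is `x ↦ -(v * star x * v)`. -/
theorem Quaternion.reflection_orthogonal_span_singleton {v : Quaternion ℝ}
    (hv : ‖v‖ = 1) (x : Quaternion ℝ) :
    ((ℝ ∙ v)ᗮ).reflection x = -(v * star x * v) := by
  rw [Submodule.reflection_orthogonal_apply, Submodule.reflection_singleton_apply, hv]
  have h1 : v * star v = 1 := by
    rw [self_mul_star, normSq_eq_norm_mul_self, hv]; simp
  have h2 : star x * v = ((2 * inner ℝ v x : ℝ) : Quaternion ℝ) - star v * x := by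
    rw [inner_def]
    ext <;> simp <;> ring
  rw [mul_assoc, h2, mul_sub, ← mul_assoc, h1, one_mul, ← coe_commutes, coe_mul_eq_smul]
  simp [two_smul, add_smul, two_mul]

/-- The determinant of the reflection in the hyperplane orthogonal to a nonzero vector is `-1`. -/
theorem Submodule.det_reflection_orthogonal_span_singleton {E : Type*}
    [NormedAddCommGroup E] [InnerProductSpace ℝ E] [FiniteDimensional ℝ E]
    {v : E} (hv : v ≠ 0) :
    LinearMap.det (((Submodule.span ℝ {v})ᗮ).reflection.toLinearEquiv : E →ₗ[ℝ] E) = -1 := by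
  have h := ((Submodule.span ℝ {v})ᗮ).det_reflection
  rw [Submodule.orthogonal_orthogonal, finrank_span_singleton hv, pow_one] at h
  exact h

/-- A product of hyperplane reflections of the quaternions is `x ↦ p * x * star q` or
`x ↦ p * star x * star q` for unit quaternions `p` and `q`, according to its determinant. -/
theorem Quaternion.prod_reflections_eq (l : List (Quaternion ℝ)) :
    let f := (l.map fun v => ((Submodule.span ℝ {v})ᗮ).reflection).prod
    ∃ p q : unitary (Quaternion ℝ),
      (LinearMap.det (f.toLinearEquiv : Quaternion ℝ →ₗ[ℝ] Quaternion ℝ) = 1 ∧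
        ∀ x, f x = p * x * star (q : Quaternion ℝ)) ∨
      (LinearMap.det (f.toLinearEquiv : Quaternion ℝ →ₗ[ℝ] Quaternion ℝ) = -1 ∧
        ∀ x, f x = p * star x * star (q : Quaternion ℝ)) := by
  induction l with
  | nil =>
    refine ⟨1, 1, Or.inl ⟨LinearMap.det_id, fun x => ?_⟩⟩
    simp
  | cons v l ih =>
    simp only [List.map_cons, List.prod_cons] at ih ⊢
    set f := (l.map fun v => ((Submodule.span ℝ {v})ᗮ).reflection).prod
    by_cases hv : v = 0
    · have h : ((Submodule.span ℝ {v})ᗮ).reflection = 1 := by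
        ext1 x
        exact Submodule.reflection_mem_subspace_eq_self (by simp [hv])
      rwa [h, one_mul]
    have hdet : LinearMap.det ((((Submodule.span ℝ {v})ᗮ).reflection * f).toLinearEquiv :
        Quaternion ℝ →ₗ[ℝ] Quaternion ℝ) =
        -LinearMap.det (f.toLinearEquiv : Quaternion ℝ →ₗ[ℝ] Quaternion ℝ) := by
      rw [← neg_one_mul, ← Submodule.det_reflection_orthogonal_span_singleton hv]
      exact LinearMap.det_comp _ _
    obtain ⟨u, hu⟩ : ∃ u : unitary (Quaternion ℝ),
        ∀ x, ((Submodule.span ℝ {v})ᗮ).reflection x = -(u * star x * u) := by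
      have hn : ‖(‖v‖⁻¹ • v)‖ = 1 := by
        simpa using norm_smul_inv_norm (𝕜 := ℝ) hv
      have hs : Submodule.span ℝ {‖v‖⁻¹ • v} = Submodule.span ℝ {v} :=
        Submodule.span_singleton_smul_eq (by simpa using hv) v
      refine ⟨⟨‖v‖⁻¹ • v, ?_⟩, fun x => ?_⟩
      · rw [Unitary.mem_iff, Quaternion.star_mul_self, Quaternion.self_mul_star,
          Quaternion.normSq_eq_norm_mul_self, hn]
        simp
      · rw [← Quaternion.reflection_orthogonal_span_singleton hn]
        simp only [hs]
    obtain ⟨p, q, ⟨hd, h⟩ | ⟨hd, h⟩⟩ := ih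
    · refine ⟨-(u * q), star u * p, Or.inr ⟨by rw [hdet, hd], fun x => ?_⟩⟩
      simp [hu, h, mul_assoc, Unitary.coe_neg]
    · refine ⟨-(u * q), star u * p, Or.inl ⟨by rw [hdet, hd, neg_neg], fun x => ?_⟩⟩
      simp [hu, h, mul_assoc, Unitary.coe_neg]

/-- Every orientation-preserving ℝ-linear isometric equivalence of the quaternions
(i.e. one whose determinant as a linear automorphism of the 4-dimensional real
vector space ℍ equals 1) is of the form `x ↦ p * x * q⁻¹` for some unit
quaternions `p` and `q`. -/
theorem orientation_preserving_isometry_eq_quaternion_conj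
    (f : (Quaternion ℝ) ≃ₗᵢ[ℝ] (Quaternion ℝ))
    (hdet : LinearMap.det (f.toLinearEquiv : Quaternion ℝ →ₗ[ℝ] Quaternion ℝ) = 1) :
    ∃ p q : unitary (Quaternion ℝ), ∀ x : Quaternion ℝ,
      f x = (p : Quaternion ℝ) * x * (q : Quaternion ℝ)⁻¹ := by
  obtain ⟨l, -, rfl⟩ := f.reflections_generate_dim
  obtain ⟨p, q, ⟨-, h⟩ | ⟨hd, -⟩⟩ := Quaternion.prod_reflections_eq l
  · refine ⟨p, q, fun x => ?_⟩
    rw [h, eq_inv_of_mul_eq_one_left (Unitary.coe_star_mul_self q)]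
  · rw [hd] at hdet
    norm_num at hdet
end

section
/- Let A and B be groups, let G̃ be a finite subgroup of A × B, and let (p,q) ∈ A × B be an element not in G̃ that normalizes G̃ and satisfies (p,q)² ∈ G̃. Let H be the subgroup generated by G̃ and (p,q), let L = pr₁(G̃) be the projection of G̃ to A, let R_K = {z ∈ B : (1,z) ∈ G̃}, and let R'_K = {z ∈ B : (1,z) ∈ H}. If p ∈ L, then R'_K = R_K ∪ {q * y : y ∈ B, (p⁻¹, y) ∈ G̃}, this union is disjoint, and the cardinality of R'_K is twice the cardinality of R_K. -/
/-- If `g` conjugates a subgroup `G` into itself and `g ^ 2 ∈ G`, then the subgroup generated by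
`G` and `g` is `G ∪ gG`. -/
theorem Subgroup.mem_closure_union_singleton_iff_of_sq_mem {Γ : Type*} [Group Γ] (G : Subgroup Γ)
    (g : Γ) (hconj : ∀ x ∈ G, g⁻¹ * x * g ∈ G) (hsq : g ^ 2 ∈ G) (x : Γ) :
    x ∈ Subgroup.closure ((G : Set Γ) ∪ {g}) ↔ x ∈ G ∨ g⁻¹ * x ∈ G := by
  constructor
  · intro hx
    induction hx using Subgroup.closure_induction with
    | mem x hx =>
      rcases hx with hx | rfl
      · exact Or.inl hx
      · exact Or.inr (by simp)
    | one => exact Or.inl G.one_mem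
    | mul x y _ _ hx hy =>
      rcases hx with hx | hx <;> rcases hy with hy | hy
      · exact Or.inl (G.mul_mem hx hy)
      · right
        have := G.mul_mem (hconj x hx) hy
        rwa [show g⁻¹ * x * g * (g⁻¹ * y) = g⁻¹ * (x * y) by group] at this
      · right
        simpa only [mul_assoc] using G.mul_mem hx hy
      · left
        have := G.mul_mem (G.mul_mem hsq (hconj _ hx)) hy
        rwa [show g ^ 2 * (g⁻¹ * (g⁻¹ * x) * g) * (g⁻¹ * y) = x * y by group] at this
    | inv x _ hx =>
      rcases hx with hx | hx
      · exact Or.inl (G.inv_mem hx)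
      · right
        have := G.mul_mem (hconj _ (G.inv_mem hx)) (G.inv_mem hsq)
        rwa [show g⁻¹ * (g⁻¹ * x)⁻¹ * g * (g ^ 2)⁻¹ = g⁻¹ * x⁻¹ by group] at this
  · have hg : g ∈ Subgroup.closure ((G : Set Γ) ∪ {g}) := Subgroup.subset_closure (Or.inr rfl)
    rintro (hx | hx)
    · exact Subgroup.subset_closure (Or.inl hx)
    · simpa using mul_mem hg (Subgroup.subset_closure (Or.inl hx))

/-- Let `G̃` be a finite subgroup of `A × B` and `(p, q) ∉ G̃` an element normalizing `G̃`
with `(p, q)² ∈ G̃`; let `H = ⟨G̃, (p,q)⟩`, `L = pr₁(G̃)`, `R_K = {z : (1,z) ∈ G̃}` and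
`R'_K = {z : (1,z) ∈ H}`.  If `p ∈ L`, then
`R'_K = R_K ∪ {q * y : (p⁻¹, y) ∈ G̃}`, this union is disjoint, and `|R'_K| = 2 |R_K|`. -/
theorem index_two_extension_kernel_of_mem {A B : Type*} [Group A] [Group B]
    (G : Subgroup (A × B)) (hfin : (G : Set (A × B)).Finite) (p : A) (q : B)
    (hnotmem : (p, q) ∉ G)
    (hnorm : (fun x : A × B => ((p, q) : A × B)⁻¹ * x * ((p, q) : A × B)) ''
      (G : Set (A × B)) = (G : Set (A × B)))
    (hsq : ((p, q) : A × B) ^ 2 ∈ G)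
    (H : Subgroup (A × B)) (hH : H = Subgroup.closure ((G : Set (A × B)) ∪ {((p, q) : A × B)}))
    (hp : p ∈ Prod.fst '' (G : Set (A × B))) :
    {z : B | ((1 : A), z) ∈ H}
        = {z : B | ((1 : A), z) ∈ G} ∪ {z : B | ∃ y : B, (p⁻¹, y) ∈ G ∧ z = q * y} ∧
    Disjoint {z : B | ((1 : A), z) ∈ G} {z : B | ∃ y : B, (p⁻¹, y) ∈ G ∧ z = q * y} ∧
    {z : B | ((1 : A), z) ∈ H}.ncard = 2 * {z : B | ((1 : A), z) ∈ G}.ncard := by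
  have hconj : ∀ x ∈ G, ((p, q) : A × B)⁻¹ * x * (p, q) ∈ G := fun x hx =>
    hnorm.subset ⟨x, hx, rfl⟩
  have hunion : {z : B | ((1 : A), z) ∈ H}
      = {z : B | ((1 : A), z) ∈ G} ∪ {z : B | ∃ y : B, (p⁻¹, y) ∈ G ∧ z = q * y} := by
    ext z
    simp only [Set.mem_union, Set.mem_ofPred_eq, hH,
      Subgroup.mem_closure_union_singleton_iff_of_sq_mem G (p, q) hconj hsq]
    refine or_congr Iff.rfl ⟨fun h => ⟨q⁻¹ * z, by simpa using h, by simp⟩, ?_⟩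
    rintro ⟨y, hy, rfl⟩
    simpa using hy
  have hdisj : Disjoint {z : B | ((1 : A), z) ∈ G}
      {z : B | ∃ y : B, (p⁻¹, y) ∈ G ∧ z = q * y} := by
    rw [Set.disjoint_left]
    rintro _ hz ⟨y, hy, rfl⟩
    exact hnotmem (by simpa using G.mul_mem hz (G.inv_mem hy))
  obtain ⟨⟨a, b⟩, hb, hab⟩ := hp
  obtain rfl : a = p := hab
  have himage : {z : B | ∃ y : B, (a⁻¹, y) ∈ G ∧ z = q * y}
      = (fun z => q * b⁻¹ * z) '' {z : B | ((1 : A), z) ∈ G} := by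
    ext z
    constructor
    · rintro ⟨y, hy, rfl⟩
      exact ⟨b * y, by simpa using G.mul_mem hb hy, by simp [mul_assoc]⟩
    · rintro ⟨w, hw, rfl⟩
      exact ⟨b⁻¹ * w, by simpa using G.mul_mem (G.inv_mem hb) hw, mul_assoc _ _ _⟩
  have hfinK : {z : B | ((1 : A), z) ∈ G}.Finite :=
    hfin.preimage (Prod.mk_right_injective (1 : A)).injOn
  refine ⟨hunion, hdisj, ?_⟩
  rw [hunion, Set.ncard_union_eq hdisj hfinK (himage ▸ hfinK.image _), himage,
    Set.ncard_image_of_injective _ (mul_right_injective _), two_mul]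
end

section
/- Let A and B be groups with distinguished central elements a ∈ A and b ∈ B satisfying a² = 1, a ≠ 1, b² = 1, b ≠ 1, let N be the subgroup of A × B generated by (a,b), and let π : A × B → (A × B)/N be the quotient map. If (x,y) ∈ A × B satisfies x² = 1, y² = 1 and (x,y) ∉ {(1,1),(a,b)}, and (u,v) ∈ A × B satisfies u² = a and v² = b, then π(x,y) and π(u,v) are not conjugate in (A × B)/N. -/
/-- Let `a ∈ A` and `b ∈ B` be central elements of order 2, `N = ⟨(a,b)⟩` and
`π : A × B → (A × B)/N` the quotient map defining the central product.  If `(x,y)`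
is an involution of `A × B` distinct from `(1,1)` and `(a,b)`, and `(u,v)` satisfies
`u² = a` and `v² = b`, then `π(x,y)` and `π(u,v)` are not conjugate in `(A × B)/N`. -/
theorem central_product_involution_not_conjugate_root {A B : Type*} [Group A] [Group B]
    (a : A) (b : B) (ha2 : a ^ 2 = 1) (ha1 : a ≠ 1) (hacentral : ∀ x : A, a * x = x * a)
    (hb2 : b ^ 2 = 1) (hb1 : b ≠ 1) (hbcentral : ∀ y : B, b * y = y * b)
    (N : Subgroup (A × B)) (hN : N = Subgroup.closure {((a, b) : A × B)}) [N.Normal]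
    (x : A) (y : B) (hx : x ^ 2 = 1) (hy : y ^ 2 = 1)
    (hxy1 : ((x, y) : A × B) ≠ 1) (hxyab : ((x, y) : A × B) ≠ (a, b))
    (u : A) (v : B) (hu : u ^ 2 = a) (hv : v ^ 2 = b) :
    ¬ ∃ k : (A × B) ⧸ N,
        (QuotientGroup.mk ((u, v) : A × B) : (A × B) ⧸ N)
          = k⁻¹ * (QuotientGroup.mk ((x, y) : A × B) : (A × B) ⧸ N) * k := by
  rintro ⟨k, hk⟩
  obtain ⟨⟨g, h⟩, rfl⟩ := QuotientGroup.mk_surjective k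
  rw [← QuotientGroup.mk_inv, ← QuotientGroup.mk_mul, ← QuotientGroup.mk_mul, eq_comm,
    QuotientGroup.eq, hN, ← Subgroup.zpowers_eq_closure] at hk
  obtain ⟨m, hm⟩ := Subgroup.mem_zpowers_iff.mp hk
  have hu_eq : u = g⁻¹ * x * g * a ^ m := by
    rw [show a ^ m = (g⁻¹ * x * g)⁻¹ * u from congrArg Prod.fst hm, mul_inv_cancel_left]
  have hcomm : Commute (g⁻¹ * x * g) (a ^ m) :=
    Commute.zpow_right (hacentral _).symm m
  have hconj : (g⁻¹ * x * g) ^ 2 = 1 := by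
    simpa [hx] using conj_pow (i := 2) (a := g⁻¹) (b := x)
  have hpow : (a ^ m) ^ 2 = 1 := by
    rw [← zpow_natCast, zpow_comm, zpow_natCast, ha2, one_zpow]
  exact ha1 (by rw [← hu, hu_eq, hcomm.mul_pow, hconj, hpow, one_mul])
end

section
/- Any two square roots of -1 in the group of unit quaternions are conjugate; specifically, if q is a quaternion with q * star q = 1 and q² = -1, then there exists a unit quaternion u such that u * q * u⁻¹ = i. -/
/-- A nonzero quaternion intertwining `q` and `p` can be normalized to a unit quaternion
conjugating `q` to `p`. -/
lemma Quaternion.exists_unit_conj_eq_of_mul_eq_mul {q p v : Quaternion ℝ} (hv : v ≠ 0)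
    (h : v * q = p * v) : ∃ u : Quaternion ℝ, u * star u = 1 ∧ u * q * u⁻¹ = p := by
  have hn : ‖v‖ ≠ 0 := norm_ne_zero_iff.mpr hv
  refine ⟨‖v‖⁻¹ • v, ?_, ?_⟩
  · rw [Quaternion.self_mul_star, Quaternion.normSq_eq_norm_mul_self, norm_smul, norm_inv,
      norm_norm, inv_mul_cancel₀ hn, mul_one, Quaternion.coe_one]
  · rw [mul_inv_eq_iff_eq_mul₀ (smul_ne_zero (inv_ne_zero hn) hv), smul_mul_assoc, h,
      mul_smul_comm]

/-- Any square root of `-1` in the group of unit quaternions is conjugate to `i`: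
if `q * star q = 1` and `q² = -1`, then there is a unit quaternion `u` with
`u * q * u⁻¹ = i`. -/
theorem unit_quaternion_sqrt_neg_one_conjugate_to_i (q : Quaternion ℝ)
    (hq : q * star q = 1) (h2 : q ^ 2 = -1) :
    ∃ u : Quaternion ℝ, u * star u = 1 ∧
      u * q * u⁻¹ = (⟨0, 1, 0, 0⟩ : Quaternion ℝ) := by
  open scoped Quaternion in
  set i : Quaternion ℝ := ⟨0, 1, 0, 0⟩ with hi
  have hii : i * i = -1 := by
    ext <;> simp <;> simp [hi]
  by_cases hv : 1 - i * q = 0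
  · have hqi : q = -i := by
      have h : i * (i * q) = i := by rw [← sub_eq_zero.mp hv, mul_one]
      rw [← mul_assoc, hii, neg_one_mul] at h
      rw [← h, neg_neg]
    let j : Quaternion ℝ := ⟨0, 0, 1, 0⟩
    refine Quaternion.exists_unit_conj_eq_of_mul_eq_mul (v := j) ?_ ?_
    · intro h
      simpa [j] using congrArg (fun x : Quaternion ℝ => x.imJ) h
    · rw [hqi]
      ext <;> simp <;> simp [hi, j]
  · refine Quaternion.exists_unit_conj_eq_of_mul_eq_mul hv ?_
    rw [sub_mul, mul_sub, mul_assoc, ← sq, h2, ← mul_assoc, hii]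
    simp [add_comm]
end

section
/- Every involution in SO(3) is conjugate to the rotation by π about the first axis: if A is a 3×3 real matrix in the special orthogonal group (Aᵀ A = 1 and det A = 1) with A² = 1 and A ≠ 1, then there exists P in the special orthogonal group with P⁻¹ A P equal to the diagonal matrix diag(1,-1,-1). -/
open Matrix in
/-- An involutive orthogonal matrix is symmetric, hence orthogonally diagonalizable, with
eigenvalues `±1`. -/
theorem Matrix.exists_orthogonal_diagonalization_of_sq_eq_one {n : Type*} [Fintype n]
    [DecidableEq n] {A : Matrix n n ℝ} (hA : A ∈ orthogonalGroup n ℝ) (h2 : A ^ 2 = 1) :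
    ∃ U ∈ orthogonalGroup n ℝ, ∃ d : n → ℝ, A * U = U * diagonal d ∧ ∀ i, d i = 1 ∨ d i = -1 := by
  have hs : A.IsHermitian := by
    have h : star A * A = 1 := (mem_unitaryGroup_iff').1 hA
    calc star A = star A * (A * A) := by rw [← sq, h2, mul_one]
      _ = A := by rw [← mul_assoc, h, one_mul]
  have hU := hs.eigenvectorUnitary.2
  have hUU : star (hs.eigenvectorUnitary : Matrix n n ℝ) * hs.eigenvectorUnitary = 1 :=
    (mem_unitaryGroup_iff').1 hU
  generalize hU' : (hs.eigenvectorUnitary : Matrix n n ℝ) = U at hU hUU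
  have hAU : A * U = U * diagonal hs.eigenvalues := by
    have h := hs.spectral_theorem
    rw [Unitary.conjStarAlgAut_apply] at h
    simp only [hU'] at h
    conv_lhs => rw [h]
    rw [mul_assoc, hUU, mul_one]
    rfl
  refine ⟨U, hU, hs.eigenvalues, hAU, fun i => ?_⟩
  have hd : diagonal hs.eigenvalues * diagonal hs.eigenvalues = 1 := by
    calc _ = star U * (U * diagonal hs.eigenvalues) * diagonal hs.eigenvalues := by
            rw [← mul_assoc, hUU, one_mul]
      _ = star U * (A ^ 2 * U) := by
            rw [← hAU, sq, mul_assoc, mul_assoc, ← hAU, mul_assoc]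
      _ = 1 := by rw [h2, one_mul, hUU]
  have hi := congrFun (congrFun hd i) i
  rw [diagonal_mul_diagonal, diagonal_apply_eq, one_apply_eq] at hi
  exact mul_self_eq_one_iff.1 hi

/-- Three signs with product `1`, not all equal to `1`, are `1, -1, -1` up to order. -/
theorem exists_perm_signs_eq {d : Fin 3 → ℝ} (hd : ∀ i, d i = 1 ∨ d i = -1)
    (hprod : ∏ i, d i = 1) (hne : d ≠ 1) :
    ∃ σ : Equiv.Perm (Fin 3), d ∘ σ = ![1, -1, -1] := by
  rw [Fin.prod_univ_three] at hprod
  rcases hd 0 with h0 | h0 <;> rcases hd 1 with h1 | h1 <;> rcases hd 2 with h2 | h2 <;>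
    rw [h0, h1, h2] at hprod <;> norm_num at hprod
  · exact absurd (by ext i; fin_cases i <;> assumption) hne
  · exact ⟨1, by ext i; fin_cases i <;> simp [h0, h1, h2]⟩
  · exact ⟨Equiv.swap 0 1, by
      ext i; fin_cases i <;> simp [h0, h1, h2, Equiv.swap_apply_def]⟩
  · exact ⟨Equiv.swap 0 2, by
      ext i; fin_cases i <;> simp [h0, h1, h2, Equiv.swap_apply_def]⟩

/-- In odd dimension, an orthogonal matrix becomes special orthogonal after a change of sign. -/
theorem Matrix.mem_specialOrthogonalGroup_or_neg_mem {n : Type*} [Fintype n] [DecidableEq n]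
    (hn : Odd (Fintype.card n)) {P : Matrix n n ℝ} (hP : P ∈ Matrix.orthogonalGroup n ℝ) :
    P ∈ Matrix.specialOrthogonalGroup n ℝ ∨ -P ∈ Matrix.specialOrthogonalGroup n ℝ := by
  have hdet : P.det * P.det = 1 := by
    have h := congrArg Matrix.det ((Matrix.mem_orthogonalGroup_iff n ℝ).1 hP)
    rwa [Matrix.det_mul, Matrix.det_transpose, Matrix.det_one] at h
  simp only [Matrix.mem_specialOrthogonalGroup_iff, Matrix.det_neg, hn.neg_one_pow]
  rcases mul_self_eq_one_iff.1 hdet with h | h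
  · exact Or.inl ⟨hP, h⟩
  · refine Or.inr ⟨?_, by rw [h]; norm_num⟩
    rw [Matrix.mem_orthogonalGroup_iff] at hP ⊢
    rwa [Matrix.transpose_neg, neg_mul_neg]

/-- Permuting the columns of an orthogonal matrix yields an orthogonal matrix. -/
theorem Matrix.submatrix_id_mem_orthogonalGroup {n : Type*} [Fintype n] [DecidableEq n]
    {U : Matrix n n ℝ} (hU : U ∈ Matrix.orthogonalGroup n ℝ) (σ : Equiv.Perm n) :
    U.submatrix id σ ∈ Matrix.orthogonalGroup n ℝ := by
  rw [Matrix.mem_orthogonalGroup_iff] at hU ⊢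
  rw [Matrix.transpose_submatrix, Matrix.submatrix_mul_equiv, hU, Matrix.submatrix_id_id]


/-- Every involution in `SO(3)` is conjugate to the rotation by `π` about the first
axis: if `A ∈ SO(3)` satisfies `A² = 1` and `A ≠ 1`, then there is `P ∈ SO(3)` with
`P⁻¹ * A * P = diag(1, -1, -1)`. -/
theorem so3_involution_conjugate_to_diag (A : Matrix (Fin 3) (Fin 3) ℝ)
    (hA : A ∈ Matrix.specialOrthogonalGroup (Fin 3) ℝ)
    (h2 : A ^ 2 = 1) (h1 : A ≠ 1) :
    ∃ P : Matrix (Fin 3) (Fin 3) ℝ, P ∈ Matrix.specialOrthogonalGroup (Fin 3) ℝ ∧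
      P⁻¹ * A * P = Matrix.diagonal ![1, -1, -1] := by
  obtain ⟨hO, hdet⟩ := Matrix.mem_specialOrthogonalGroup_iff.1 hA
  obtain ⟨U, hU, d, hAU, hd⟩ := Matrix.exists_orthogonal_diagonalization_of_sq_eq_one hO h2
  have hUU : U * U.transpose = 1 := (Matrix.mem_orthogonalGroup_iff _ _).1 hU
  have hU0 : U.det ≠ 0 := fun h => by
    simpa [h] using congrArg Matrix.det hUU
  have hprod : ∏ i, d i = 1 := by
    have h := congrArg Matrix.det hAU
    rw [Matrix.det_mul, Matrix.det_mul, hdet, Matrix.det_diagonal, one_mul] at h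
    exact mul_left_cancel₀ hU0 (by rw [← h, mul_one])
  have hne : d ≠ 1 := by
    rintro rfl
    apply h1
    have h : A * U = U := by rw [hAU, Matrix.diagonal_one', mul_one]
    rw [← mul_one A, ← hUU, ← mul_assoc, h]
  obtain ⟨σ, hσ⟩ := exists_perm_signs_eq hd hprod hne
  have hAQ : A * U.submatrix id σ = U.submatrix id σ * Matrix.diagonal ![1, -1, -1] := by
    rw [← hσ, ← Matrix.submatrix_diagonal_equiv, Matrix.submatrix_mul_equiv, ← hAU]
    rfl
  have conj_eq : ∀ P ∈ Matrix.specialOrthogonalGroup (Fin 3) ℝ,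
      A * P = P * Matrix.diagonal ![1, -1, -1] →
        P⁻¹ * A * P = Matrix.diagonal ![1, -1, -1] := by
    intro P hP h
    have hu : IsUnit P.det := (Matrix.mem_specialOrthogonalGroup_iff.1 hP).2 ▸ isUnit_one
    rw [mul_assoc, h, Matrix.nonsing_inv_mul_cancel_left _ _ hu]
  rcases Matrix.mem_specialOrthogonalGroup_or_neg_mem (by decide)
    (Matrix.submatrix_id_mem_orthogonalGroup hU σ) with h | h
  · exact ⟨_, h, conj_eq _ h hAQ⟩
  · exact ⟨_, h, conj_eq _ h (by rw [mul_neg, neg_mul, hAQ])⟩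
end

section
/- Let K = O(2)* be the subgroup {q ∈ unitary ℍ : q * i * q⁻¹ = i or q * i * q⁻¹ = -i} of the unit quaternions. Then: (1) the only element of K of order 2 is -1; (2) every z ∈ K with z² = -1 is conjugate in K to i or to j; (3) i and j are not conjugate in K. -/
/-- The imaginary unit `i` of the quaternions. -/
noncomputable def qI : Quaternion ℝ := ⟨0, 1, 0, 0⟩

/-- The imaginary unit `j` of the quaternions. -/
noncomputable def qJ : Quaternion ℝ := ⟨0, 0, 1, 0⟩

/-- The subgroup `O(2)* = {q ∈ unitary ℍ : q i q⁻¹ = ± i}` of the unit quaternions,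
as a set of quaternions. -/
noncomputable def O2star : Set (Quaternion ℝ) :=
  {q : Quaternion ℝ | q ∈ unitary (Quaternion ℝ) ∧
    (q * qI * q⁻¹ = qI ∨ q * qI * q⁻¹ = -qI)}

@[simp] theorem qI_re : qI.re = 0 := rfl

@[simp] theorem qI_imI : qI.imI = 1 := rfl

@[simp] theorem qI_imJ : qI.imJ = 0 := rfl

@[simp] theorem qI_imK : qI.imK = 0 := rfl

@[simp] theorem qJ_re : qJ.re = 0 := rfl

@[simp] theorem qJ_imI : qJ.imI = 0 := rfl

@[simp] theorem qJ_imJ : qJ.imJ = 1 := rfl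

@[simp] theorem qJ_imK : qJ.imK = 0 := rfl

theorem mem_unitary_iff_sum_sq_eq_one (q : Quaternion ℝ) :
    q ∈ unitary (Quaternion ℝ) ↔ q.re ^ 2 + q.imI ^ 2 + q.imJ ^ 2 + q.imK ^ 2 = 1 := by
  rw [Unitary.mem_iff, Quaternion.star_mul_self, Quaternion.self_mul_star, and_self,
    ← Quaternion.normSq_def']
  exact Quaternion.coe_inj (y := 1)

/-- `O(2)*` is the union of `S¹` and `S¹ j`, in coordinates. -/
theorem mem_O2star_iff (q : Quaternion ℝ) :
    q ∈ O2star ↔ (q.re ^ 2 + q.imI ^ 2 = 1 ∧ q.imJ = 0 ∧ q.imK = 0) ∨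
      (q.re = 0 ∧ q.imI = 0 ∧ q.imJ ^ 2 + q.imK ^ 2 = 1) := by
  have hunit := mem_unitary_iff_sum_sq_eq_one q
  rw [O2star, Set.mem_ofPred_eq, hunit]
  by_cases hq : q = 0
  · simp [hq, Quaternion.re_zero, Quaternion.imI_zero, Quaternion.imJ_zero,
      Quaternion.imK_zero]
  rw [mul_inv_eq_iff_eq_mul₀ hq, mul_inv_eq_iff_eq_mul₀ hq]
  simp only [Quaternion.ext_iff, qI_re, qI_imI, qI_imJ, qI_imK,
    Quaternion.re_mul, Quaternion.imI_mul, Quaternion.imJ_mul,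
    Quaternion.imK_mul, Quaternion.re_neg, Quaternion.imI_neg, Quaternion.imJ_neg,
    Quaternion.imK_neg]
  constructor
  · rintro ⟨h, ⟨-, -, hJ, hK⟩ | ⟨hR, hI, -, -⟩⟩
    · have hj : q.imJ = 0 := by linarith
      have hk : q.imK = 0 := by linarith
      left
      simpa [hj, hk] using h
    · have hr : q.re = 0 := by linarith
      have hi : q.imI = 0 := by linarith
      right
      simpa [hr, hi] using h
  · rintro (⟨h, hj, hk⟩ | ⟨hr, hi, h⟩)
    · simp [hj, hk, h]
    · simp [hr, hi, h]

theorem ne_zero_of_mem_O2star {q : Quaternion ℝ} (hq : q ∈ O2star) : q ≠ 0 := by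
  rintro rfl
  simp [mem_O2star_iff, Quaternion.re_zero, Quaternion.imI_zero, Quaternion.imJ_zero,
    Quaternion.imK_zero] at hq

theorem inv_mul_mul_eq_iff {u : Quaternion ℝ} (hu : u ∈ O2star) (z w : Quaternion ℝ) :
    u⁻¹ * z * u = w ↔ z * u = u * w := by
  rw [mul_assoc, inv_mul_eq_iff_eq_mul₀ (ne_zero_of_mem_O2star hu)]

theorem exists_conj_qI {z : Quaternion ℝ} (hj : z.imJ = 0) (hk : z.imK = 0) (hz : z ^ 2 = -1) :
    ∃ u ∈ O2star, u⁻¹ * z * u = qI := by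
  have hzz : z * z = -1 := by rw [← sq, hz]
  simp only [Quaternion.ext_iff, Quaternion.re_mul, Quaternion.imI_mul, Quaternion.re_neg,
    Quaternion.imI_neg, Quaternion.re_one, Quaternion.imI_one, hj, hk] at hzz
  obtain ⟨hre, him, -, -⟩ := hzz
  have hr : z.re = 0 := by
    rcases mul_eq_zero.1 (show z.re * z.imI = 0 by linarith) with h | h
    · exact h
    · rw [h] at hre
      nlinarith [mul_self_nonneg z.re]
  have hi : z.imI * z.imI = 1 := by
    rw [hr] at hre
    linarith
  rcases mul_self_eq_one_iff.1 hi with h | h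
  · have h1 : (1 : Quaternion ℝ) ∈ O2star := by
      simp [mem_O2star_iff, Quaternion.re_one, Quaternion.imI_one, Quaternion.imJ_one,
        Quaternion.imK_one]
    refine ⟨1, h1, (inv_mul_mul_eq_iff h1 _ _).2 ?_⟩
    rw [mul_one, one_mul]
    simp [Quaternion.ext_iff, hr, h, hj, hk]
  · have hJ : qJ ∈ O2star := by simp [mem_O2star_iff]
    refine ⟨qJ, hJ, (inv_mul_mul_eq_iff hJ _ _).2 ?_⟩
    simp [Quaternion.ext_iff, hr, h, hj, hk]

/-- A unit quaternion `c j + d k` is conjugated to `j` by a square root of `c + d i`. -/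
theorem exists_conj_qJ {z : Quaternion ℝ} (hr : z.re = 0) (hi : z.imI = 0)
    (h : z.imJ ^ 2 + z.imK ^ 2 = 1) : ∃ u ∈ O2star, u⁻¹ * z * u = qJ := by
  obtain ⟨w, hw⟩ := IsAlgClosed.exists_pow_nat_eq (⟨z.imJ, z.imK⟩ : ℂ) two_pos
  simp only [sq, Complex.ext_iff, Complex.mul_re, Complex.mul_im] at hw
  obtain ⟨hc, hd⟩ := hw
  have hnorm : w.re ^ 2 + w.im ^ 2 = 1 := by
    have hsq : (w.re ^ 2 + w.im ^ 2) ^ 2 = 1 := by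
      rw [← h, ← hc, ← hd]
      ring
    exact (pow_eq_one_iff_of_nonneg (by positivity) two_ne_zero).1 hsq
  obtain ⟨u, hur, hui, huj, huk⟩ : ∃ u : Quaternion ℝ,
      u.re = w.re ∧ u.imI = w.im ∧ u.imJ = 0 ∧ u.imK = 0 :=
    ⟨⟨w.re, w.im, 0, 0⟩, rfl, rfl, rfl, rfl⟩
  have hu : u ∈ O2star := by simp [mem_O2star_iff, hur, hui, huj, huk, hnorm]
  refine ⟨_, hu, (inv_mul_mul_eq_iff hu _ _).2 ?_⟩
  ext <;> simp [hr, hi, hur, hui, huj, huk, ← hc, ← hd]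
  · linear_combination w.re * hnorm
  · linear_combination w.im * hnorm

theorem not_conj_qI_qJ : ¬ ∃ u ∈ O2star, u⁻¹ * qI * u = qJ := by
  rintro ⟨u, hu, h⟩
  rw [inv_mul_mul_eq_iff hu] at h
  simp only [Quaternion.ext_iff, qI_re, qI_imI, qI_imJ, qI_imK, qJ_re, qJ_imI, qJ_imJ,
    qJ_imK, Quaternion.re_mul, Quaternion.imI_mul,
    Quaternion.imJ_mul, Quaternion.imK_mul] at h
  obtain ⟨h1, h2, h3, h4⟩ := h
  rcases (mem_O2star_iff u).1 hu with ⟨hn, hj, hk⟩ | ⟨hr, hi, hn⟩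
  · have hr : u.re = 0 := by linarith
    have hi : u.imI = 0 := by linarith
    simp [hr, hi] at hn
  · have hj : u.imJ = 0 := by linarith
    have hk : u.imK = 0 := by linarith
    simp [hj, hk] at hn

/-- In `K = O(2)*`: (1) the only element of order 2 is `-1`; (2) every `z ∈ K` with
`z² = -1` is conjugate in `K` to `i` or to `j`; (3) `i` and `j` are not conjugate in
`K`. -/
theorem o2star_involutions_and_roots :
    (∀ q ∈ O2star, q ^ 2 = 1 → q ≠ 1 → q = -1) ∧
    (∀ z ∈ O2star, z ^ 2 = -1 →
      ((∃ u ∈ O2star, u⁻¹ * z * u = qI) ∨ (∃ u ∈ O2star, u⁻¹ * z * u = qJ))) ∧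
    ¬ ∃ u ∈ O2star, u⁻¹ * qI * u = qJ := by
  refine ⟨fun q _ hq hne => ?_, fun z hz hsq => ?_, not_conj_qI_qJ⟩
  · exact (mul_self_eq_one_iff.1 (by rwa [← sq])).resolve_left hne
  · rcases (mem_O2star_iff z).1 hz with ⟨-, hj, hk⟩ | ⟨hr, hi, h⟩
    · exact .inl (exists_conj_qI hj hk hsq)
    · exact .inr (exists_conj_qJ hr hi h)
end

section
/- In the central product O(2) ×̃ O(2) = (O(2) × O(2))/N, where N is the subgroup generated by (-1,-1), a complete set of representatives for the conjugacy classes of elements of order 2 is given by the cosets of (-1,1), (1,c), (c,1), (c,c) and (r,r), where c = diag(1,-1) and r is the rotation by π/2: these five cosets have order exactly 2, are pairwise non-conjugate, and every element of order 2 in the quotient is conjugate to one of them. -/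
/-- The orthogonal group `O(2)` of 2×2 real matrices. -/
abbrev O2G := ↥(Matrix.orthogonalGroup (Fin 2) ℝ)

/-- The reflection `c = diag(1, -1)` as an element of `O(2)`. -/
noncomputable def cO2 : O2G :=
  ⟨!![(1 : ℝ), 0; 0, -1], by
    rw [Matrix.mem_orthogonalGroup_iff]
    ext i j
    fin_cases i <;> fin_cases j <;>
      simp [Matrix.mul_apply, Fin.sum_univ_two, Matrix.star_apply]⟩

/-- The rotation by `π/2` as an element of `O(2)`. -/
noncomputable def rO2 : O2G :=
  ⟨!![(0 : ℝ), -1; 1, 0], by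
    rw [Matrix.mem_orthogonalGroup_iff]
    ext i j
    fin_cases i <;> fin_cases j <;>
      simp [Matrix.mul_apply, Fin.sum_univ_two, Matrix.star_apply]⟩

/-- The element `-1` of `O(2)`. -/
noncomputable def negO2 : O2G := ⟨-1, by rw [Matrix.mem_orthogonalGroup_iff]; simp⟩

/-- The central subgroup `N` of `O(2) × O(2)` generated by `(-1, -1)`. -/
noncomputable def N15 : Subgroup (O2G × O2G) := Subgroup.closure {(negO2, negO2)}

instance : N15.Normal := by
  have hc : (negO2, negO2) ∈ Subgroup.center (O2G × O2G) := by
    rw [Subgroup.mem_center_iff]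
    intro g
    have h1 : ∀ x : O2G, x * negO2 = negO2 * x := by
      intro x
      ext
      simp [negO2, mul_neg, neg_mul]
    exact Prod.ext_iff.mpr ⟨by simpa using (h1 g.1), by simpa using (h1 g.2)⟩
  have hle : N15 ≤ Subgroup.center (O2G × O2G) :=
    (Subgroup.closure_le _).mpr
      (by intro x hx; rw [Set.mem_singleton_iff] at hx; subst hx; exact hc)
  constructor
  intro n hn g
  have h2 : g * n * g⁻¹ = n := by
    rw [Subgroup.mem_center_iff.mp (hle hn) g, mul_assoc, mul_inv_cancel, mul_one]
  rwa [h2]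

/-- The quotient map `O(2) × O(2) → O(2) ×̃ O(2)` onto the central product. -/
noncomputable def π15 (x : O2G × O2G) : (O2G × O2G) ⧸ N15 := QuotientGroup.mk x

theorem O2G.ext_entries {a b : O2G} (h₀₀ : a.1 0 0 = b.1 0 0) (h₀₁ : a.1 0 1 = b.1 0 1)
    (h₁₀ : a.1 1 0 = b.1 1 0) (h₁₁ : a.1 1 1 = b.1 1 1) : a = b := by
  apply Subtype.ext
  ext i j
  fin_cases i <;> fin_cases j <;> assumption

/-- Inverses in `O(2)` are transposes. -/
theorem O2G.inv_apply (a : O2G) (i j : Fin 2) : (a⁻¹).1 i j = a.1 j i := rfl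

theorem O2G.mul_apply (a b : O2G) (i j : Fin 2) :
    (a * b).1 i j = a.1 i 0 * b.1 0 j + a.1 i 1 * b.1 1 j := by
  simp [Matrix.mul_apply, Fin.sum_univ_two]

theorem O2G.one_apply (i j : Fin 2) : (1 : O2G).1 i j = (1 : Matrix (Fin 2) (Fin 2) ℝ) i j := rfl

theorem negO2_mul_apply (a : O2G) (i j : Fin 2) : (negO2 * a).1 i j = -a.1 i j := by
  simp [negO2]

theorem negO2_mul_negO2 : negO2 * negO2 = 1 := by
  apply Subtype.ext
  simp [negO2]

theorem cO2_mul_cO2 : cO2 * cO2 = 1 := by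
  apply O2G.ext_entries <;> simp [O2G.one_apply, cO2]

theorem rO2_mul_rO2 : rO2 * rO2 = negO2 := by
  apply O2G.ext_entries <;> simp [rO2, negO2]

/-- The reflections `c` and `-c` are conjugate. -/
theorem negO2_mul_conj_cO2 (k : O2G) :
    negO2 * (k⁻¹ * cO2 * k) = (rO2 * k)⁻¹ * cO2 * (rO2 * k) := by
  apply O2G.ext_entries <;>
    (rw [negO2_mul_apply]; simp [O2G.mul_apply, O2G.inv_apply, cO2, rO2])

theorem O2G.row_norms (a : O2G) :
    a.1 0 0 ^ 2 + a.1 0 1 ^ 2 = 1 ∧ a.1 1 0 ^ 2 + a.1 1 1 ^ 2 = 1 := by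
  have h (i : Fin 2) : (a * a⁻¹).1 i i = 1 := by simp
  have h0 := h 0
  have h1 := h 1
  rw [O2G.mul_apply] at h0 h1
  simp only [O2G.inv_apply] at h0 h1
  constructor <;> linarith

/-- Every point of the unit circle is the square of a point of the unit circle. -/
theorem exists_half_angle {p q : ℝ} (h : p ^ 2 + q ^ 2 = 1) :
    ∃ u v : ℝ, u ^ 2 + v ^ 2 = 1 ∧ u ^ 2 - v ^ 2 = p ∧ 2 * u * v = q := by
  obtain ⟨z, hz⟩ := IsAlgClosed.exists_pow_nat_eq (⟨p, q⟩ : ℂ) two_pos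
  have hre := congrArg Complex.re hz
  have him := congrArg Complex.im hz
  simp only [pow_two, Complex.mul_re, Complex.mul_im] at hre him
  refine ⟨z.re, z.im, ?_, by linarith, by linarith⟩
  have hsq : (z.re ^ 2 + z.im ^ 2) ^ 2 = 1 := by
    rw [← h, ← hre, ← him]
    ring
  nlinarith [sq_nonneg z.re, sq_nonneg z.im]

theorem eq_conj_cO2 {a : O2G} (hs : a.1 1 0 = a.1 0 1) (ht : a.1 1 1 = -a.1 0 0) :
    ∃ k, a = k⁻¹ * cO2 * k := by
  obtain ⟨u, v, h1, h2, h3⟩ := exists_half_angle a.row_norms.1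
  have hk : !![u, v; -v, u] ∈ Matrix.orthogonalGroup (Fin 2) ℝ := by
    rw [Matrix.mem_orthogonalGroup_iff]
    ext i j
    fin_cases i <;> fin_cases j <;>
      simp [Matrix.mul_apply, Fin.sum_univ_two] <;> linarith
  refine ⟨⟨_, hk⟩, ?_⟩
  apply O2G.ext_entries <;>
    simp [O2G.mul_apply, O2G.inv_apply, cO2] <;> linarith

/-- The square roots of `1` in `O(2)` are `1`, `-1` and the reflections. -/
theorem O2G.eq_of_mul_self_eq_one {a : O2G} (h : a * a = 1) :
    a = 1 ∨ a = negO2 ∨ ∃ k, a = k⁻¹ * cO2 * k := by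
  have hinv : a⁻¹ = a := inv_eq_of_mul_eq_one_right h
  have hs : a.1 1 0 = a.1 0 1 := by rw [← O2G.inv_apply, hinv]
  have h01 : (a * a).1 0 1 = 0 := by rw [h]; simp
  rw [O2G.mul_apply] at h01
  obtain ⟨hr0, hr1⟩ := a.row_norms
  by_cases ht : a.1 1 1 = -a.1 0 0
  · exact Or.inr (Or.inr (eq_conj_cO2 hs ht))
  have hsum : a.1 0 0 + a.1 1 1 ≠ 0 := fun h' => ht (by linarith)
  have hq : a.1 0 1 = 0 :=
    (mul_eq_zero.mp (by linarith : (a.1 0 0 + a.1 1 1) * a.1 0 1 = 0)).resolve_left hsum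
  have hpt : a.1 0 0 = a.1 1 1 := by
    apply mul_left_cancel₀ hsum
    rw [hs] at hr1
    linarith
  have hp : a.1 0 0 ^ 2 = 1 := by simpa [hq] using hr0
  rcases sq_eq_sq_iff_eq_or_eq_neg.mp (hp.trans (one_pow 2).symm) with hp | hp
  · left
    apply O2G.ext_entries <;> simp [O2G.one_apply, hs, hq, ← hpt, hp]
  · right; left
    apply O2G.ext_entries <;> simp [negO2, hs, hq, ← hpt, hp]

/-- The square roots of `-1` in `O(2)` are the conjugates of `r`. -/
theorem O2G.eq_conj_rO2_of_mul_self {a : O2G} (h : a * a = negO2) :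
    ∃ k, a = k⁻¹ * rO2 * k := by
  have hinv : a⁻¹ = negO2 * a := by
    apply inv_eq_of_mul_eq_one_left
    rw [mul_assoc, h, negO2_mul_negO2]
  have hneg (i j : Fin 2) : a.1 j i = -a.1 i j := by
    rw [← O2G.inv_apply, hinv, negO2_mul_apply]
  have h00 : a.1 0 0 = 0 := by linarith [hneg 0 0]
  have h11 : a.1 1 1 = 0 := by linarith [hneg 1 1]
  have h10 := hneg 0 1
  have hq : a.1 0 1 ^ 2 = 1 := by simpa [h00] using a.row_norms.1
  rcases sq_eq_sq_iff_eq_or_eq_neg.mp (hq.trans (one_pow 2).symm) with hq | hq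
  · refine ⟨cO2, ?_⟩
    apply O2G.ext_entries <;>
      simp [O2G.mul_apply, O2G.inv_apply, cO2, rO2, h00, h11, h10, hq]
  · refine ⟨1, ?_⟩
    rw [inv_one, one_mul, mul_one]
    apply O2G.ext_entries <;> simp [rO2, h00, h11, h10, hq]

theorem mem_N15 {x : O2G × O2G} : x ∈ N15 ↔ x = 1 ∨ x = (negO2, negO2) := by
  constructor
  · intro hx
    induction hx using Subgroup.closure_induction with
    | mem x hx => exact Or.inr hx
    | one => exact Or.inl rfl
    | mul x y _ _ hx hy =>
      rcases hx with rfl | rfl <;> rcases hy with rfl | rfl <;>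
        simp [negO2_mul_negO2]
    | inv x _ hx =>
      rcases hx with rfl | rfl
      · simp
      · exact Or.inr (inv_eq_of_mul_eq_one_right (by simp [negO2_mul_negO2]))
  · rintro (rfl | rfl)
    · exact one_mem _
    · exact Subgroup.subset_closure rfl

theorem π15_eq_one {x : O2G × O2G} : π15 x = 1 ↔ x = 1 ∨ x = (negO2, negO2) :=
  (QuotientGroup.eq_one_iff x).trans mem_N15

theorem π15_mul (x y : O2G × O2G) : π15 (x * y) = π15 x * π15 y := rfl

theorem π15_conj (a b k l : O2G) :
    π15 (k⁻¹ * a * k, l⁻¹ * b * l) = (π15 (k, l))⁻¹ * π15 (a, b) * π15 (k, l) := rfl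

theorem π15_negO2_mul (a b : O2G) : π15 (negO2 * a, negO2 * b) = π15 (a, b) := by
  have h : π15 (negO2, negO2) = 1 := π15_eq_one.mpr (Or.inr rfl)
  have h' : π15 (negO2 * a, negO2 * b) = π15 (negO2, negO2) * π15 (a, b) := rfl
  rw [h', h, one_mul]

theorem O2G.trace_conj (a k : O2G) : (k⁻¹ * a * k).1.trace = a.1.trace := by
  rw [Submonoid.coe_mul, Matrix.trace_mul_comm, ← Submonoid.coe_mul, mul_inv_cancel_left]

theorem O2G.det_conj (a k : O2G) : (k⁻¹ * a * k).1.det = a.1.det := by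
  rw [Submonoid.coe_mul, Matrix.det_mul_comm, ← Submonoid.coe_mul, mul_inv_cancel_left]

theorem negO2_mul_coe (a : O2G) : (negO2 * a).1 = -a.1 := by
  simp [negO2]

/-- Squared traces and determinants of the components are class functions on the central
product. -/
theorem π15_conj_invariants {x y : O2G × O2G} (h : ∃ k, π15 y = k⁻¹ * π15 x * k) :
    y.1.1.trace ^ 2 = x.1.1.trace ^ 2 ∧ y.2.1.trace ^ 2 = x.2.1.trace ^ 2 ∧
      y.1.1.det = x.1.1.det := by
  obtain ⟨k, hk⟩ := h
  obtain ⟨⟨k, l⟩, rfl⟩ := QuotientGroup.mk_surjective k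
  obtain ⟨a, b⟩ := x
  have hy : π15 (y * (k⁻¹ * a * k, l⁻¹ * b * l)⁻¹) = 1 :=
    mul_inv_eq_one.mpr hk
  rcases π15_eq_one.mp hy with h | h
  · rw [mul_inv_eq_one.mp h]
    exact ⟨by rw [O2G.trace_conj], by rw [O2G.trace_conj], O2G.det_conj a k⟩
  · rw [mul_inv_eq_iff_eq_mul.mp h]
    simp only [Prod.mk_mul_mk, negO2_mul_coe, Matrix.trace_neg, O2G.trace_conj, even_two.neg_pow,
      Matrix.det_neg, O2G.det_conj, Fintype.card_fin, one_pow, one_mul, and_self]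

theorem π15_sq_eq_one {x : O2G × O2G} :
    π15 x ^ 2 = 1 ↔ (x.1 * x.1 = 1 ∧ x.2 * x.2 = 1) ∨
      (x.1 * x.1 = negO2 ∧ x.2 * x.2 = negO2) := by
  rw [pow_two, ← π15_mul, π15_eq_one, Prod.ext_iff, Prod.ext_iff]
  rfl

/-- In the central product `O(2) ×̃ O(2)`, the cosets of `(-1,1)`, `(1,c)`, `(c,1)`,
`(c,c)` and `(r,r)` form a complete set of representatives for the conjugacy classes
of elements of order 2: each has order exactly 2, they are pairwise non-conjugate, and
every element of order 2 of the quotient is conjugate to one of them. -/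
theorem central_product_O2_O2_involution_classes :
    (∀ e ∈ [π15 (negO2, 1), π15 (1, cO2), π15 (cO2, 1), π15 (cO2, cO2), π15 (rO2, rO2)],
        e ^ 2 = 1 ∧ e ≠ 1) ∧
    ([π15 (negO2, 1), π15 (1, cO2), π15 (cO2, 1), π15 (cO2, cO2),
        π15 (rO2, rO2)].Pairwise fun e e' => ¬ ∃ k, e' = k⁻¹ * e * k) ∧
    (∀ x : (O2G × O2G) ⧸ N15, x ^ 2 = 1 → x ≠ 1 →
      ∃ e ∈ [π15 (negO2, 1), π15 (1, cO2), π15 (cO2, 1), π15 (cO2, cO2), π15 (rO2, rO2)],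
        ∃ k, x = k⁻¹ * e * k) := by
  have hcn : cO2.1 0 0 = 1 ∧ cO2.1 1 1 = -1 := by simp [cO2]
  have hnn : negO2.1 0 0 = -1 ∧ negO2.1 1 1 = -1 := by simp [negO2]
  have hrn : rO2.1 0 0 = 0 := by simp [rO2]
  have hc1 : cO2 ≠ 1 := fun h => by
    have h' := hcn.2
    rw [h, O2G.one_apply] at h'
    norm_num at h'
  have hn1 : negO2 ≠ 1 := fun h => by
    have h' := hnn.2
    rw [h, O2G.one_apply] at h'
    norm_num at h'
  have hcneg : cO2 ≠ negO2 := fun h => by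
    have h' := hcn.1
    rw [h, hnn.1] at h'
    norm_num at h'
  have hr1 : rO2 ≠ 1 := fun h => by
    rw [h, O2G.one_apply] at hrn
    norm_num at hrn
  have hrneg : rO2 ≠ negO2 := fun h => by
    rw [h, hnn.1] at hrn
    norm_num at hrn
  refine ⟨?_, ?_, ?_⟩
  · simp [π15_sq_eq_one, π15_eq_one, negO2_mul_negO2, cO2_mul_cO2, rO2_mul_rO2, hc1, hn1,
      hcneg, hr1, hrneg, hn1.symm]
  · have htc : cO2.1.trace = 0 := by simp [cO2, Matrix.trace_fin_two]
    have htr : rO2.1.trace = 0 := by simp [rO2, Matrix.trace_fin_two]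
    have htn : negO2.1.trace = -2 := by simp [negO2]
    have ht1 : (1 : O2G).1.trace = 2 := by simp
    have hdc : cO2.1.det = -1 := by simp [cO2]
    have hdr : rO2.1.det = 1 := by simp [rO2]
    simp only [List.pairwise_cons, List.mem_cons, List.not_mem_nil, or_false,
      forall_eq_or_imp, forall_eq, IsEmpty.forall_iff, implies_true, List.Pairwise.nil, and_true]
    refine ⟨⟨?_, ?_, ?_, ?_⟩, ⟨?_, ?_, ?_⟩, ⟨?_, ?_⟩, ?_⟩ <;>
    · intro h
      obtain ⟨h1, h2, h3⟩ := π15_conj_invariants h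
      simp only [htc, htr, htn, ht1, hdc, hdr] at h1 h2 h3
      norm_num at *
  · intro x hx hx1
    obtain ⟨⟨a, b⟩, rfl⟩ := QuotientGroup.mk_surjective x
    change π15 (a, b) ^ 2 = 1 at hx
    change π15 (a, b) ≠ 1 at hx1
    change ∃ e ∈ _, ∃ k, π15 (a, b) = k⁻¹ * e * k
    simp only [List.mem_cons, List.not_mem_nil, or_false, exists_eq_or_imp, exists_eq_left]
    rcases π15_sq_eq_one.mp hx with ⟨ha, hb⟩ | ⟨ha, hb⟩
    · rcases O2G.eq_of_mul_self_eq_one ha with rfl | rfl | ⟨k, rfl⟩ <;>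
        rcases O2G.eq_of_mul_self_eq_one hb with rfl | rfl | ⟨l, rfl⟩
      · exact absurd rfl hx1
      · refine Or.inl ⟨1, ?_⟩
        rw [← π15_negO2_mul, negO2_mul_negO2, mul_one, inv_one, one_mul, mul_one]
      · refine Or.inr (Or.inl ⟨π15 (1, l), ?_⟩)
        rw [← π15_conj, inv_one, one_mul, one_mul]
      · refine Or.inl ⟨1, ?_⟩
        rw [inv_one, one_mul, mul_one]
      · exact absurd (π15_eq_one.mpr (Or.inr rfl)) hx1
      · refine Or.inr (Or.inl ⟨π15 (1, rO2 * l), ?_⟩)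
        rw [← π15_negO2_mul, negO2_mul_negO2, negO2_mul_conj_cO2, ← π15_conj, inv_one, one_mul,
          one_mul]
      · refine Or.inr (Or.inr (Or.inl ⟨π15 (k, 1), ?_⟩))
        rw [← π15_conj, inv_one, one_mul, one_mul]
      · refine Or.inr (Or.inr (Or.inl ⟨π15 (rO2 * k, 1), ?_⟩))
        rw [← π15_negO2_mul, negO2_mul_negO2, negO2_mul_conj_cO2, ← π15_conj, inv_one, one_mul,
          one_mul]
      · exact Or.inr (Or.inr (Or.inr (Or.inl ⟨π15 (k, l), π15_conj _ _ _ _⟩)))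
    · obtain ⟨k, rfl⟩ := O2G.eq_conj_rO2_of_mul_self ha
      obtain ⟨l, rfl⟩ := O2G.eq_conj_rO2_of_mul_self hb
      exact Or.inr (Or.inr (Or.inr (Or.inr ⟨π15 (k, l), π15_conj _ _ _ _⟩)))
end

section
/- Let m, n, r, s be positive integers with r odd and s odd, and let gcd(r,s) = 1. In the group Circle × Circle, writing e(t) for exp(2πit), the subgroup generated by the four elements (e(1/(2mr)), e(s/(2nr))), (e(1/(2m)), 1), (1, e(1/(2n))), and (e(1/(4m)), e((s+1)/(4n))) equals the subgroup generated by the three elements (e(1/(4mr)), e((r+s)/(4nr))), (e(1/(4m)), 1), and (1, e(1/(2n))). (This identifies the index-2 extension of the Family 1 group (C_{2mr}/C_{2m}, C_{2nr}/C_{2n})_s by the involution lift (e^{iπ/2m}, e^{i(s+1)π/2n}) as the Family 1 group (C_{4mr}/C_{4m}, C_{2nr}/C_{2n})_{(r+s)/2}.) -/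
open Real

/-- The point `e(t) = exp(2πit)` of the circle group. -/
noncomputable def ee (t : ℝ) : Circle := Circle.exp (2 * π * t)

theorem ee_zero : ee 0 = 1 := by simp [ee]

theorem ee_add (a b : ℝ) : ee (a + b) = ee a * ee b := by
  simp [ee, mul_add, Circle.exp_add]

theorem ee_neg (a : ℝ) : ee (-a) = (ee a)⁻¹ := by
  simp [ee, Circle.exp_neg]

theorem ee_nat_mul (k : ℕ) (a : ℝ) : ee (k * a) = ee a ^ k := by
  induction k with
  | zero => simp [ee_zero]
  | succ k ih => rw [Nat.cast_succ, add_mul, one_mul, ee_add, ih, pow_succ]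

/-- For `m, n, r, s` positive with `r, s` odd and `gcd(r,s) = 1`, the subgroup of
`Circle × Circle` generated by the Family 1 group `(C_{2mr}/C_{2m}, C_{2nr}/C_{2n})_s`
together with the involution lift `(e(1/(4m)), e((s+1)/(4n)))` equals the Family 1
group `(C_{4mr}/C_{4m}, C_{2nr}/C_{2n})_{(r+s)/2}`. -/
theorem family_one_extension_odd_case (m n r s : ℕ)
    (hm : 0 < m) (hn : 0 < n) (hr : 0 < r) (hs : 0 < s)
    (hrodd : Odd r) (hsodd : Odd s) (hgcd : Nat.gcd r s = 1) :
    Subgroup.closure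
        ({(ee (1 / (2 * m * r)), ee (s / (2 * n * r))),
          (ee (1 / (2 * m)), 1),
          (1, ee (1 / (2 * n))),
          (ee (1 / (4 * m)), ee ((s + 1) / (4 * n)))} : Set (Circle × Circle)) =
      Subgroup.closure
        ({(ee (1 / (4 * m * r)), ee ((r + s) / (4 * n * r))),
          (ee (1 / (4 * m)), 1),
          (1, ee (1 / (2 * n)))} : Set (Circle × Circle)) := by
  have hm' : (m : ℝ) ≠ 0 := by positivity
  have hn' : (n : ℝ) ≠ 0 := by positivity
  have hr' : (r : ℝ) ≠ 0 := by positivity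
  obtain ⟨k, hk⟩ := hrodd
  obtain ⟨l, hl⟩ := hsodd
  have hkr : (r : ℝ) = 2 * k + 1 := by exact_mod_cast hk
  have hls : (s : ℝ) = 2 * l + 1 := by exact_mod_cast hl
  apply le_antisymm
  · rw [Subgroup.closure_le]
    simp only [Set.subset_def, SetLike.mem_coe]
    set H := Subgroup.closure
        ({(ee (1 / (4 * m * r)), ee ((r + s) / (4 * n * r))),
          (ee (1 / (4 * m)), 1),
          (1, ee (1 / (2 * n)))} : Set (Circle × Circle))
    have h1 : (ee (1 / (4 * m * r)), ee ((r + s) / (4 * n * r))) ∈ H :=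
      Subgroup.subset_closure (by simp)
    have h2 : (ee (1 / (4 * m)), 1) ∈ H := Subgroup.subset_closure (by simp)
    have h3 : (1, ee (1 / (2 * n))) ∈ H := Subgroup.subset_closure (by simp)
    rintro x (rfl | rfl | rfl | rfl)
    · convert H.mul_mem (H.pow_mem h1 2) (H.inv_mem h3) using 1
      ext1
      · simp only [Prod.pow_mk, Prod.inv_mk, Prod.mk_mul_mk, inv_one, mul_one, ← ee_nat_mul]
        congr 1
        push_cast
        field_simp
        norm_num
      · simp only [Prod.pow_mk, Prod.inv_mk, Prod.mk_mul_mk, ← ee_nat_mul, ← ee_neg, ← ee_add]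
        congr 1
        push_cast
        field_simp
        ring
    · convert H.pow_mem h2 2 using 1
      ext1
      · simp only [Prod.pow_mk, ← ee_nat_mul]
        congr 1
        push_cast
        field_simp
        norm_num
      · simp
    · exact h3
    · convert H.mul_mem h2 (H.pow_mem h3 (l + 1)) using 1
      ext1
      · simp
      · simp only [Prod.pow_mk, Prod.mk_mul_mk, one_mul, ← ee_nat_mul]
        congr 1
        push_cast
        rw [hls]
        field_simp
        ring
  · rw [Subgroup.closure_le]
    simp only [Set.subset_def, SetLike.mem_coe]
    set G := Subgroup.closure
        ({(ee (1 / (2 * m * r)), ee (s / (2 * n * r))),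
          (ee (1 / (2 * m)), 1),
          (1, ee (1 / (2 * n))),
          (ee (1 / (4 * m)), ee ((s + 1) / (4 * n)))} : Set (Circle × Circle))
    have g1 : (ee (1 / (2 * m * r)), ee (s / (2 * n * r))) ∈ G :=
      Subgroup.subset_closure (by simp)
    have g3 : (1, ee (1 / (2 * n))) ∈ G := Subgroup.subset_closure (by simp)
    have g4 : (ee (1 / (4 * m)), ee ((s + 1) / (4 * n))) ∈ G :=
      Subgroup.subset_closure (by simp)
    have hk' : (k : ℝ) = (r - 1) / 2 := by linarith
    rintro x (rfl | rfl | rfl)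
    · convert G.mul_mem g4 (G.inv_mem (G.pow_mem g1 k)) using 1
      ext1 <;>
      · simp only [Prod.pow_mk, Prod.inv_mk, Prod.mk_mul_mk, ← ee_nat_mul, ← ee_neg, ← ee_add]
        congr 1
        rw [hk']
        field_simp
        ring
    · convert G.mul_mem g4 (G.inv_mem (G.pow_mem g3 (l + 1))) using 1
      ext1
      · simp
      · simp only [Prod.pow_mk, Prod.inv_mk, Prod.mk_mul_mk, ← ee_nat_mul, ← ee_neg, ← ee_add,
          ← ee_zero]
        congr 1
        push_cast
        rw [hls]
        field_simp
        ring
    · exact g3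
end
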